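/- Well-posedness of n(·): for every nonnegative vector q : I → ℝ, the feasible set S(q) is nonempty and upward closed (if τ ∈ S(q) and τ ≤ τ', then τ' ∈ S(q)); moreover n(q) > 0 and the infimum is attained, i.e., n(q) ∈ S(q), so that ∑_{i ∈ I} (if q i < (1/n(q))^{1/(k i)} then c i else 0) ≤ n(q). -/

import Mathlib

open Finset

/-- The feasible set `S(q) = {τ > 0 | ∑_i c_i · 1[q_i < (1/τ)^{1/k_i}] ≤ τ}`. -/
noncomputable def feasibleSet {I : Type*} [Fintype I] (c : I → ℝ) (k : I → ℕ)
    (q : I → ℝ) : Set ℝ :=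
  {τ : ℝ | 0 < τ ∧ ∑ i, (if q i < (1 / τ) ^ ((1 : ℝ) / (k i)) then c i else 0) ≤ τ}

/-- The threshold `n(q) = inf S(q)`. -/
noncomputable def nVal {I : Type*} [Fintype I] (c : I → ℝ) (k : I → ℕ) (q : I → ℝ) : ℝ :=
  sInf (feasibleSet c k q)

theorem feasibleSet_nonempty {I : Type*} [Fintype I] [Nonempty I] {c : I → ℝ}
    (hc : ∀ i, 0 < c i) (k : I → ℕ) (q : I → ℝ) : (feasibleSet c k q).Nonempty := by
  refine ⟨∑ i, c i, sum_pos (fun i _ => hc i) univ_nonempty, sum_le_sum fun i _ => ?_⟩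
  split_ifs
  · exact le_rfl
  · exact (hc i).le

theorem isUpperSet_feasibleSet {I : Type*} [Fintype I] {c : I → ℝ} (hc : ∀ i, 0 ≤ c i)
    (k : I → ℕ) (q : I → ℝ) : IsUpperSet (feasibleSet c k q) := by
  rintro τ τ' h ⟨h0, hτ⟩
  refine ⟨h0.trans_le h, le_trans (sum_le_sum fun i _ => ?_) (hτ.trans h)⟩
  have hpow : (1 / τ') ^ ((1 : ℝ) / (k i)) ≤ (1 / τ) ^ ((1 : ℝ) / (k i)) :=
    Real.rpow_le_rpow (one_div_nonneg.2 (h0.trans_le h).le)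
      (one_div_le_one_div_of_le h0 h) (by positivity)
  split_ifs with h1 h2
  · exact le_rfl
  · exact absurd (h1.trans_le hpow) h2
  · exact hc i
  · exact le_rfl

theorem le_of_mem_feasibleSet {I : Type*} [Fintype I] {c : I → ℝ} (hc : ∀ i, 1 ≤ c i)
    {k : I → ℕ} {q : I → ℝ} {i : I} (hk : k i ≠ 0) (hq : 0 ≤ q i) {τ : ℝ}
    (hτ : τ ∈ feasibleSet c k q) : 1 / (1 + q i ^ k i) ≤ τ := by
  obtain ⟨h0, hsum⟩ := hτ
  have hpow : 0 ≤ q i ^ k i := pow_nonneg hq _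
  rw [div_le_iff₀ (by positivity)]
  by_cases hi : q i < (1 / τ) ^ ((1 : ℝ) / (k i))
  · have hle : c i ≤ τ := by
      refine le_trans ?_ hsum
      have := single_le_sum (f := fun j => if q j < (1 / τ) ^ ((1 : ℝ) / (k j)) then c j else 0)
        (fun j _ => by
          split_ifs
          · exact zero_le_one.trans (hc j)
          · exact le_rfl) (mem_univ i)
      simpa only [if_pos hi] using this
    nlinarith [hc i]
  · have h1 : 1 / τ ≤ q i ^ k i := by
      have := pow_le_pow_left₀ (by positivity) (not_lt.1 hi) (k i)
      rwa [one_div (k i : ℝ), Real.rpow_inv_natCast_pow (by positivity) hk] at this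
    rw [div_le_iff₀ h0] at h1
    nlinarith

theorem nVal_pos {I : Type*} [Fintype I] [Nonempty I] {c : I → ℝ} (hc : ∀ i, 1 ≤ c i)
    {k : I → ℕ} (hk : ∀ i, k i ≠ 0) {q : I → ℝ} (hq : ∀ i, 0 ≤ q i) : 0 < nVal c k q := by
  obtain ⟨i, -⟩ := exists_true_iff_nonempty.2 ‹Nonempty I›
  have hpow : 0 ≤ q i ^ k i := pow_nonneg (hq i) _
  exact lt_of_lt_of_le (by positivity : 0 < 1 / (1 + q i ^ k i))
    (le_csInf (feasibleSet_nonempty (fun j => zero_lt_one.trans_le (hc j)) k q)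
      fun _ hτ => le_of_mem_feasibleSet hc (hk i) (hq i) hτ)

/-- The cost is lower semicontinuous in `τ > 0`, so a positive infimum is attained. -/
theorem nVal_mem_feasibleSet {I : Type*} [Fintype I] {c : I → ℝ} (hc : ∀ i, 0 ≤ c i)
    {k : I → ℕ} {q : I → ℝ} (hne : (feasibleSet c k q).Nonempty) (hpos : 0 < nVal c k q) :
    nVal c k q ∈ feasibleSet c k q := by
  refine ⟨hpos, ?_⟩
  set n := nVal c k q
  have hmem : ∀ τ, n < τ → τ ∈ feasibleSet c k q := fun τ hτ => by
    obtain ⟨σ, hσ, hlt⟩ := exists_lt_of_csInf_lt hne hτ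
    exact isUpperSet_feasibleSet hc k q hlt.le hσ
  have hact : ∀ᶠ τ in nhds n, ∀ i, q i < (1 / n) ^ ((1 : ℝ) / (k i)) →
      q i < (1 / τ) ^ ((1 : ℝ) / (k i)) := by
    refine Filter.eventually_all.2 fun i => Filter.eventually_imp_distrib_left.2 fun hi => ?_
    have hcont : ContinuousAt (fun τ : ℝ => (1 / τ) ^ ((1 : ℝ) / (k i))) n :=
      (continuousAt_const.div continuousAt_id hpos.ne').rpow_const
        (Or.inl (one_div_pos.2 hpos).ne')
    exact hcont.eventually_const_lt hi
  refine ge_of_tendsto (Filter.tendsto_id.mono_left nhdsWithin_le_nhds :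
    Filter.Tendsto id (nhdsWithin n (Set.Ioi n)) (nhds n)) ?_
  filter_upwards [self_mem_nhdsWithin, nhdsWithin_le_nhds hact] with τ hτ hτact
  refine le_trans (sum_le_sum fun i _ => ?_) (hmem τ hτ).2
  split_ifs with h1 h2
  · exact le_rfl
  · exact absurd (hτact i h1) h2
  · exact hc i
  · exact le_rfl

/-- Well-posedness of `n(·)`: the feasible set is nonempty and upward closed,
`n(q) > 0`, the infimum is attained, and consequently
`∑_i c_i · 1[q_i < (1/n(q))^{1/k_i}] ≤ n(q)`. -/
theorem stmt_5 {I : Type*} [Fintype I] [Nonempty I]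
    (c : I → ℝ) (hc : ∀ i, 1 ≤ c i) (k : I → ℕ) (hk : ∀ i, 1 ≤ k i)
    (q : I → ℝ) (hq : ∀ i, 0 ≤ q i) :
    (feasibleSet c k q).Nonempty ∧
    (∀ τ τ' : ℝ, τ ∈ feasibleSet c k q → τ ≤ τ' → τ' ∈ feasibleSet c k q) ∧
    0 < nVal c k q ∧
    nVal c k q ∈ feasibleSet c k q ∧
    ∑ i, (if q i < (1 / nVal c k q) ^ ((1 : ℝ) / (k i)) then c i else 0) ≤ nVal c k q := by
  have hc0 : ∀ i, 0 < c i := fun i => zero_lt_one.trans_le (hc i)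
  have hne := feasibleSet_nonempty hc0 k q
  have hpos := nVal_pos hc (fun i => Nat.one_le_iff_ne_zero.1 (hk i)) hq
  have hmem := nVal_mem_feasibleSet (fun i => (hc0 i).le) hne hpos
  exact ⟨hne, fun _ _ hτ h => isUpperSet_feasibleSet (fun i => (hc0 i).le) k q h hτ,
    hpos, hmem, hmem.2⟩
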